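/- For a uniform random vector V_N on the unit sphere S^{N−1} and 0 < ν ≤ 1/2, there exist universal constants C_1, C_2 > 0 such that C_1·ν·log(e/ν) ≤ E[∑_{k=1}^{⌊νN⌋} (V_N)_{(k)}^2] ≤ C_2·ν·log(e/ν), where (V_N)_{(1)} ≥ (V_N)_{(2)} ≥ ... is the decreasing rearrangement of the absolute values of the coordinates of V_N. -/

import Mathlib

open MeasureTheory

/-- The distribution of a standard Gaussian vector in `ℝ^N`. -/
noncomputable def stdGaussian (N : ℕ) : Measure (Fin N → ℝ) :=
  Measure.pi fun _ => ProbabilityTheory.gaussianReal 0 1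

/-- A uniform random vector on the unit sphere `S^{N-1}`, realized by normalizing a standard
Gaussian vector. -/
noncomputable def unifSphere {N : ℕ} (ω : Fin N → ℝ) : Fin N → ℝ :=
  fun i => ω i / Real.sqrt (∑ j, ω j ^ 2)

/-- The sum of the `L` largest squared coordinates of the normalized vector. -/
noncomputable def topSum {N : ℕ} (L : ℕ) (ω : Fin N → ℝ) : ℝ :=
  ⨆ A : {A : Finset (Fin N) // A.card ≤ L}, ∑ j ∈ A.1, unifSphere ω j ^ 2

instance (N : ℕ) : IsProbabilityMeasure (stdGaussian N) := by
  unfold stdGaussian; infer_instance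

lemma unifSphere_sq {N : ℕ} (ω : Fin N → ℝ) (i : Fin N) :
    unifSphere ω i ^ 2 = ω i ^ 2 / ∑ j, ω j ^ 2 := by
  rw [unifSphere, div_pow, Real.sq_sqrt (Finset.sum_nonneg fun _ _ => sq_nonneg _)]

lemma sum_unifSphere_sq {N : ℕ} (ω : Fin N → ℝ) (A : Finset (Fin N)) :
    ∑ i ∈ A, unifSphere ω i ^ 2 = (∑ i ∈ A, ω i ^ 2) / ∑ j, ω j ^ 2 := by
  simp_rw [unifSphere_sq, Finset.sum_div]

lemma le_topSum {N L : ℕ} (ω : Fin N → ℝ) {A : Finset (Fin N)} (hA : A.card ≤ L) :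
    (∑ i ∈ A, ω i ^ 2) / ∑ j, ω j ^ 2 ≤ topSum L ω := by
  rw [← sum_unifSphere_sq]
  exact le_ciSup (f := fun A : {A : Finset (Fin N) // A.card ≤ L} =>
    ∑ j ∈ A.1, unifSphere ω j ^ 2) (Set.finite_range _).bddAbove ⟨A, hA⟩

lemma topSum_nonneg {N : ℕ} (L : ℕ) (ω : Fin N → ℝ) : 0 ≤ topSum L ω := by
  simpa using le_topSum ω (A := ∅) (Nat.zero_le L)

lemma topSum_le {N L : ℕ} (ω : Fin N → ℝ) {c : ℝ}
    (h : ∀ A : Finset (Fin N), A.card ≤ L → (∑ i ∈ A, ω i ^ 2) / ∑ j, ω j ^ 2 ≤ c) :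
    topSum L ω ≤ c := by
  have : Nonempty {A : Finset (Fin N) // A.card ≤ L} := ⟨∅, by simp⟩
  refine ciSup_le fun A => ?_
  rw [sum_unifSphere_sq]
  exact h A.1 A.2

lemma topSum_le_one {N : ℕ} (L : ℕ) (ω : Fin N → ℝ) : topSum L ω ≤ 1 :=
  topSum_le ω fun A _ => div_le_one_of_le₀
    (Finset.sum_le_sum_of_subset_of_nonneg A.subset_univ fun _ _ _ => sq_nonneg _)
    (Finset.sum_nonneg fun _ _ => sq_nonneg _)

lemma integrable_topSum (N L : ℕ) : Integrable (topSum L) (stdGaussian N) := by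
  have hm : Measurable (topSum (N := N) L) := by
    unfold topSum unifSphere
    exact Measurable.iSup fun A => by fun_prop
  refine Integrable.of_bound hm.aestronglyMeasurable 1 (ae_of_all _ fun ω => ?_)
  rw [Real.norm_of_nonneg (topSum_nonneg L ω)]
  exact topSum_le_one L ω

lemma integral_exp_mul_sq_gaussianReal {a : ℝ} (ha : a < 1 / 2) :
    ∫ x, Real.exp (a * x ^ 2) ∂(ProbabilityTheory.gaussianReal 0 1) = (√(1 - 2 * a))⁻¹ := by
  rw [ProbabilityTheory.integral_gaussianReal_eq_integral_smul one_ne_zero]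
  have h : ∀ x : ℝ, ProbabilityTheory.gaussianPDFReal 0 1 x • Real.exp (a * x ^ 2) =
      (√(2 * Real.pi))⁻¹ * Real.exp (-(1 / 2 - a) * x ^ 2) := fun x => by
    rw [ProbabilityTheory.gaussianPDFReal, smul_eq_mul, mul_assoc, ← Real.exp_add]
    simp only [NNReal.coe_one, mul_one]
    ring_nf
  simp_rw [h]
  rw [integral_const_mul, integral_gaussian, ← Real.sqrt_inv, ← Real.sqrt_inv,
    ← Real.sqrt_mul (by positivity)]
  have : 1 - 2 * a ≠ 0 := by linarith
  have : 1 / 2 - a ≠ 0 := by linarith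
  congr 1
  field_simp

lemma integrable_exp_mul_sq_gaussianReal {a : ℝ} (ha : a < 1 / 2) :
    Integrable (fun x => Real.exp (a * x ^ 2)) (ProbabilityTheory.gaussianReal 0 1) := by
  refine Integrable.of_integral_ne_zero ?_
  rw [integral_exp_mul_sq_gaussianReal ha]
  have : 0 < 1 - 2 * a := by linarith
  positivity

lemma exp_mul_sum_sq {N : ℕ} (a : ℝ) (ω : Fin N → ℝ) :
    Real.exp (a * ∑ j, ω j ^ 2) = ∏ j, Real.exp (a * ω j ^ 2) := by
  rw [Finset.mul_sum, Real.exp_sum]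

lemma integral_exp_mul_sum_sq {a : ℝ} (ha : a < 1 / 2) (N : ℕ) :
    ∫ ω, Real.exp (a * ∑ j, ω j ^ 2) ∂(stdGaussian N) = (√(1 - 2 * a))⁻¹ ^ N := by
  simp_rw [exp_mul_sum_sq, stdGaussian]
  rw [integral_fintype_prod_eq_pow (fun x => Real.exp (a * x ^ 2)),
    integral_exp_mul_sq_gaussianReal ha, Fintype.card_fin]

lemma integrable_exp_mul_sum_sq {a : ℝ} (ha : a < 1 / 2) (N : ℕ) :
    Integrable (fun ω => Real.exp (a * ∑ j, ω j ^ 2)) (stdGaussian N) := by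
  simp_rw [exp_mul_sum_sq, stdGaussian]
  exact Integrable.fintype_prod fun _ => integrable_exp_mul_sq_gaussianReal ha

lemma integral_exp_coord {a : ℝ} (ha : a < 1 / 2) {N : ℕ} (j : Fin N) :
    ∫ ω, Real.exp (a * ω j ^ 2) ∂(stdGaussian N) = (√(1 - 2 * a))⁻¹ := by
  rw [← integral_exp_mul_sq_gaussianReal ha, stdGaussian]
  exact integral_comp_eval (μ := fun _ : Fin N => ProbabilityTheory.gaussianReal 0 1)
    (f := fun x => Real.exp (a * x ^ 2))
    (integrable_exp_mul_sq_gaussianReal ha).aestronglyMeasurable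

lemma integrable_exp_coord {a : ℝ} (ha : a < 1 / 2) {N : ℕ} (j : Fin N) :
    Integrable (fun ω => Real.exp (a * ω j ^ 2)) (stdGaussian N) :=
  integrable_comp_eval (μ := fun _ : Fin N => ProbabilityTheory.gaussianReal 0 1)
    (integrable_exp_mul_sq_gaussianReal ha)

lemma exp_neg_div_eight_le_gaussianReal {t : ℝ} (ht : 0 ≤ t) :
    Real.exp (-t) / 8 ≤ (ProbabilityTheory.gaussianReal 0 1).real {x | t ≤ x ^ 2} := by
  have hs := Real.sqrt_nonneg t
  have hst := Real.sq_sqrt ht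
  set s := √t
  calc Real.exp (-t) / 8
      ≤ (ProbabilityTheory.gaussianReal 0 1).real (Set.Icc s (s + 1)) := by
        rw [Measure.real, ProbabilityTheory.gaussianReal_apply_eq_integral _ one_ne_zero,
          ENNReal.toReal_ofReal
            (integral_nonneg fun _ => ProbabilityTheory.gaussianPDFReal_nonneg _ _ _)]
        have h := setIntegral_ge_of_const_le_real (μ := volume) (s := Set.Icc s (s + 1))
          (f := ProbabilityTheory.gaussianPDFReal 0 1) (c := Real.exp (-t) / 8)
          measurableSet_Icc (by simp) (fun x hx => ?_)
          (ProbabilityTheory.integrable_gaussianPDFReal 0 1).integrableOn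
        · simpa using h
        · rw [ProbabilityTheory.gaussianPDFReal]
          simp only [NNReal.coe_one, mul_one, sub_zero]
          have h1 : Real.exp (-t) * Real.exp (-1) ≤ Real.exp (-x ^ 2 / 2) := by
            rw [← Real.exp_add, Real.exp_le_exp]
            have : x ^ 2 ≤ (s + 1) ^ 2 := pow_le_pow_left₀ (hs.trans hx.1) hx.2 2
            nlinarith [sq_nonneg (s - 1)]
          have h2 : √(2 * Real.pi) ≤ 2.6 := by
            rw [Real.sqrt_le_left (by norm_num)]
            linarith [Real.pi_lt_d2]
          have h3 : (1 : ℝ) / 8 ≤ (√(2 * Real.pi))⁻¹ * Real.exp (-1) := by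
            rw [Real.exp_neg, ← mul_inv, one_div]
            refine inv_anti₀ (by positivity) ?_
            have := Real.exp_one_lt_d9
            calc √(2 * Real.pi) * Real.exp 1 ≤ 2.6 * 2.72 := by gcongr; linarith
              _ ≤ 8 := by norm_num
          calc Real.exp (-t) / 8 = 1 / 8 * Real.exp (-t) := by ring
            _ ≤ (√(2 * Real.pi))⁻¹ * Real.exp (-1) * Real.exp (-t) := by gcongr
            _ = (√(2 * Real.pi))⁻¹ * (Real.exp (-t) * Real.exp (-1)) := by ring
            _ ≤ _ := by gcongr
    _ ≤ _ := measureReal_mono fun x hx => by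
        rw [Set.mem_ofPred_eq, ← hst]
        exact pow_le_pow_left₀ hs hx.1 2

lemma exists_subset_card_mul_sum_le {ι : Type*} (f : ι → ℝ) (s : Finset ι) {k : ℕ}
    (hk : k ≤ s.card) :
    ∃ A ⊆ s, A.card = k ∧ k * ∑ i ∈ s, f i ≤ s.card * ∑ i ∈ A, f i := by
  classical
  induction h : s.card - k generalizing s with
  | zero => exact ⟨s, subset_rfl, by lia, by rw [show k = s.card by lia]⟩
  | succ n ih =>
    obtain ⟨m, hm, hmin⟩ := s.exists_min_image f (Finset.card_pos.1 (by lia))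
    have hc := Finset.card_erase_add_one hm
    obtain ⟨A, hA, hAk, hle⟩ := ih (s.erase m) (by lia) (by lia)
    refine ⟨A, hA.trans (s.erase_subset m), hAk, ?_⟩
    have h1 : (k : ℝ) * f m ≤ ∑ i ∈ A, f i := by
      rw [← hAk, ← nsmul_eq_mul]
      exact A.card_nsmul_le_sum f _ fun i hi => hmin i (Finset.mem_of_mem_erase (hA hi))
    rw [← hc, ← Finset.add_sum_erase s f hm]
    push_cast
    linarith

lemma div_le_topSum {N L : ℕ} (hL : L ≤ N) {ω : Fin N → ℝ} (hω : 0 < ∑ j, ω j ^ 2) :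
    (L : ℝ) / N ≤ topSum L ω := by
  obtain ⟨A, -, hA, h⟩ := exists_subset_card_mul_sum_le (fun i => ω i ^ 2)
    (Finset.univ : Finset (Fin N)) (k := L) (by simpa using hL)
  refine le_trans ?_ (le_topSum ω hA.le)
  rw [Finset.card_univ, Fintype.card_fin] at h
  rcases Nat.eq_zero_or_pos N with rfl | hN
  · simp
  · rw [div_le_div_iff₀ (by exact_mod_cast hN) hω]
    linarith

lemma half_div_le_integral_topSum {N L : ℕ} (hN : 1 ≤ N) (hL : L ≤ N) :
    (L : ℝ) / N / 2 ≤ ∫ ω, topSum L ω ∂(stdGaussian N) := by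
  have hi := integrable_exp_mul_sum_sq (a := -3 / 2) (by norm_num) N
  have hs : √(1 - 2 * (-3 / 2 : ℝ)) = 2 := by
    rw [show 1 - 2 * (-3 / 2 : ℝ) = 2 ^ 2 by norm_num, Real.sqrt_sq (by norm_num)]
  calc (L : ℝ) / N / 2 ≤ L / N * (1 - (2⁻¹ : ℝ) ^ N) := by
        have : (2⁻¹ : ℝ) ^ N ≤ 2⁻¹ := pow_le_of_le_one (by norm_num) (by norm_num) (by lia)
        rw [div_eq_mul_inv (_ / _)]
        gcongr
        linarith
    _ = ∫ ω, (L : ℝ) / N * (1 - Real.exp (-3 / 2 * ∑ j, ω j ^ 2)) ∂(stdGaussian N) := by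
        rw [integral_const_mul, integral_sub (integrable_const _) hi,
          integral_exp_mul_sum_sq (by norm_num), hs]
        simp
    _ ≤ _ := by
        refine integral_mono (((integrable_const _).sub hi).const_mul _) (integrable_topSum N L)
          fun ω => ?_
        rcases (Finset.sum_nonneg fun j _ => sq_nonneg (ω j) : 0 ≤ ∑ j, ω j ^ 2).eq_or_lt with h | h
        · simpa [← h] using topSum_nonneg L ω
        · refine le_trans ?_ (div_le_topSum hL h)
          exact mul_le_of_le_one_right (by positivity)
            (sub_le_self _ (Real.exp_pos _).le)

lemma integral_topSum_le {N : ℕ} (hN : 1 ≤ N) (L : ℕ) {t : ℝ} (ht : 0 ≤ t) :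
    ∫ ω, topSum L ω ∂(stdGaussian N) ≤
      4 / N * (L * t + N * (4 * Real.exp (-t / 4) * √2)) + (3 / 4) ^ N := by
  have hN' : (0 : ℝ) < N := by exact_mod_cast hN
  have hi := integrable_exp_mul_sum_sq (a := -3 / 2) (by norm_num) N
  have hj := fun j : Fin N => integrable_exp_coord (a := 1 / 4) (by norm_num) j
  have hs : √(1 - 2 * (-3 / 2 : ℝ)) = 2 := by
    rw [show 1 - 2 * (-3 / 2 : ℝ) = 2 ^ 2 by norm_num, Real.sqrt_sq (by norm_num)]
  have hs' : (√(1 - 2 * (1 / 4 : ℝ)))⁻¹ = √2 := by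
    rw [← Real.sqrt_inv]; norm_num
  have hi1 : Integrable (fun ω : Fin N → ℝ => 4 / N * (L * t +
      ∑ j, 4 * Real.exp (-t / 4) * Real.exp (1 / 4 * ω j ^ 2))) (stdGaussian N) :=
    ((integrable_const _).add
      (integrable_finsetSum _ fun j _ => (hj j).const_mul _)).const_mul _
  have hi2 := hi.const_mul (Real.exp (3 / 8) ^ N)
  calc _ ≤ ∫ ω, (4 / N * (L * t + ∑ j, 4 * Real.exp (-t / 4) * Real.exp (1 / 4 * ω j ^ 2)) +
        Real.exp (3 / 8) ^ N * Real.exp (-3 / 2 * ∑ j, ω j ^ 2)) ∂(stdGaussian N) := by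
        refine integral_mono (integrable_topSum N L) (hi1.add hi2) fun ω => ?_
        rcases lt_or_ge (∑ j, ω j ^ 2) (N / 4) with h | h
        · have : 1 ≤ Real.exp (3 / 8) ^ N * Real.exp (-3 / 2 * ∑ j, ω j ^ 2) := by
            rw [← Real.exp_nat_mul, ← Real.exp_add]
            exact Real.one_le_exp (by linarith)
          have h0 : 0 ≤ 4 / (N : ℝ) *
              (L * t + ∑ j, 4 * Real.exp (-t / 4) * Real.exp (1 / 4 * ω j ^ 2)) := by positivity
          exact (topSum_le_one L ω).trans (this.trans (le_add_of_nonneg_left h0))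
        · have h0 : 0 ≤ Real.exp (3 / 8) ^ N * Real.exp (-3 / 2 * ∑ j, ω j ^ 2) := by positivity
          refine le_trans (topSum_le ω fun A hA => ?_) (le_add_of_nonneg_right h0)
          have hx : ∀ j, ω j ^ 2 ≤ t + 4 * Real.exp (-t / 4) * Real.exp (1 / 4 * ω j ^ 2) := by
            intro j
            rw [mul_assoc, ← Real.exp_add]
            linarith [Real.add_one_le_exp (-t / 4 + 1 / 4 * ω j ^ 2)]
          have hA' : ∑ i ∈ A, ω i ^ 2 ≤
              L * t + ∑ j, 4 * Real.exp (-t / 4) * Real.exp (1 / 4 * ω j ^ 2) := by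
            calc ∑ i ∈ A, ω i ^ 2
                ≤ ∑ i ∈ A, (t + 4 * Real.exp (-t / 4) * Real.exp (1 / 4 * ω i ^ 2)) :=
                  Finset.sum_le_sum fun i _ => hx i
              _ = A.card * t + ∑ i ∈ A, 4 * Real.exp (-t / 4) * Real.exp (1 / 4 * ω i ^ 2) := by
                  rw [Finset.sum_add_distrib, Finset.sum_const, nsmul_eq_mul]
              _ ≤ _ := by
                  gcongr
                  exact A.subset_univ
          calc _ ≤ (L * t + ∑ j, 4 * Real.exp (-t / 4) * Real.exp (1 / 4 * ω j ^ 2)) /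
                (N / 4) := by gcongr
            _ = _ := by field_simp
    _ = 4 / N * (L * t + N * (4 * Real.exp (-t / 4) * √2)) + (Real.exp (3 / 8) / 2) ^ N := by
        rw [integral_add hi1 hi2, integral_const_mul, integral_const_mul,
          integral_add (integrable_const _)
            (integrable_finsetSum _ fun j _ => (hj j).const_mul _),
          integral_finsetSum _ fun j _ => (hj j).const_mul _,
          integral_exp_mul_sum_sq (by norm_num), hs]
        simp_rw [integral_const_mul, integral_exp_coord (a := 1 / 4) (by norm_num), hs']
        simp [div_eq_mul_inv, mul_pow]
    _ ≤ _ := by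
        have : Real.exp (3 / 8) ≤ 3 / 2 := by
          refine le_of_pow_le_pow_left₀ (n := 8) (by norm_num) (by norm_num) ?_
          calc Real.exp (3 / 8) ^ 8 = Real.exp 1 ^ 3 := by
                rw [← Real.exp_nat_mul, ← Real.exp_nat_mul]; norm_num
            _ ≤ 2.72 ^ 3 := by
                gcongr
                linarith [Real.exp_one_lt_d9]
            _ ≤ _ := by norm_num
        have : Real.exp (3 / 8) / 2 ≤ 3 / 4 := by linarith
        gcongr

lemma integral_ite_le {t p : ℝ}
    (hp : p ≤ (ProbabilityTheory.gaussianReal 0 1).real {x | t ≤ x ^ 2}) :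
    ∫ x, (if t ≤ x ^ 2 then (1 / 2 : ℝ) else 1) ∂(ProbabilityTheory.gaussianReal 0 1) ≤
      Real.exp (-p / 2) := by
  have hm : MeasurableSet {x : ℝ | t ≤ x ^ 2} := measurableSet_le (by fun_prop) (by fun_prop)
  have h : ∀ x : ℝ, (if t ≤ x ^ 2 then (1 / 2 : ℝ) else 1) =
      1 - {x : ℝ | t ≤ x ^ 2}.indicator (fun _ => 1 / 2) x := fun x => by
    by_cases hx : t ≤ x ^ 2 <;> simp [hx]; norm_num
  simp_rw [h]
  rw [integral_sub (integrable_const _) ((integrable_const _).indicator hm),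
    integral_indicator_const _ hm]
  simp only [integral_const, probReal_univ, smul_eq_mul]
  linarith [Real.add_one_le_exp (-p / 2)]

lemma le_integral_topSum {N L : ℕ} (hN : 1 ≤ N) (hL : 1 ≤ L) {t p : ℝ} (ht : 0 ≤ t)
    (hp : p ≤ (ProbabilityTheory.gaussianReal 0 1).real {x | t ≤ x ^ 2}) (hpL : 6 * L ≤ p * N) :
    t * L / (16 * N) ≤ ∫ ω, topSum L ω ∂(stdGaussian N) := by
  have hN' : (0 : ℝ) < N := by exact_mod_cast hN
  have hL' : (1 : ℝ) ≤ L := by exact_mod_cast hL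
  set g : ℝ → ℝ := fun x => if t ≤ x ^ 2 then 1 / 2 else 1 with hg
  have hgi : Integrable g (ProbabilityTheory.gaussianReal 0 1) := by
    refine Integrable.of_bound (Measurable.ite (measurableSet_le (by fun_prop) (by fun_prop))
      measurable_const measurable_const).aestronglyMeasurable 1 (ae_of_all _ fun x => ?_)
    by_cases hx : t ≤ x ^ 2 <;> simp [hg, hx]; norm_num
  have hg0 : ∀ x, 0 ≤ g x := fun x => by by_cases hx : t ≤ x ^ 2 <;> simp [hg, hx]
  have hi := (integrable_exp_mul_sum_sq (a := 1 / 4) (by norm_num) N).const_mul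
    (Real.exp (-2) ^ N)
  have hi' : Integrable (fun ω => (2 : ℝ) ^ L * ∏ j, g (ω j)) (stdGaussian N) :=
    (Integrable.fintype_prod fun _ => hgi).const_mul _
  have he := Real.exp_one_gt_d9
  have h1 : ∫ ω, Real.exp (-2) ^ N * Real.exp (1 / 4 * ∑ j, ω j ^ 2) ∂(stdGaussian N) ≤
      1 / 4 := by
    rw [integral_const_mul, integral_exp_mul_sum_sq (by norm_num), ← mul_pow]
    have hs' : (√(1 - 2 * (1 / 4 : ℝ)))⁻¹ = √2 := by
      rw [← Real.sqrt_inv]; norm_num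
    have hs2 : √2 ≤ 1.5 := by rw [Real.sqrt_le_left (by norm_num)]; norm_num
    have h4 : Real.exp (-2) * √2 ≤ 1 / 4 := by
      rw [Real.exp_neg, show (2 : ℝ) = 1 + 1 by norm_num, Real.exp_add]
      rw [show (1 + 1 : ℝ) = 2 by norm_num, inv_mul_le_iff₀ (by positivity)]
      nlinarith
    rw [hs']
    exact (pow_le_of_le_one (by positivity) (by linarith) (by lia)).trans h4
  have h2 : ∫ ω, (2 : ℝ) ^ L * ∏ j, g (ω j) ∂(stdGaussian N) ≤ 1 / 4 := by
    rw [integral_const_mul, stdGaussian, integral_fintype_prod_eq_pow g, Fintype.card_fin]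
    calc (2 : ℝ) ^ L * (∫ x, g x ∂(ProbabilityTheory.gaussianReal 0 1)) ^ N
        ≤ Real.exp 1 ^ L * Real.exp (-p / 2) ^ N := by
          have h0 : 0 ≤ ∫ x, g x ∂(ProbabilityTheory.gaussianReal 0 1) :=
            integral_nonneg fun x => hg0 x
          have h2 : (2 : ℝ) ≤ Real.exp 1 := by linarith
          have h3 := integral_ite_le hp
          gcongr
      _ ≤ Real.exp (-2) := by
          rw [← Real.exp_nat_mul, ← Real.exp_nat_mul, ← Real.exp_add, Real.exp_le_exp]
          linarith
      _ ≤ 1 / 4 := by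
          rw [Real.exp_neg, one_div]
          refine inv_anti₀ (by norm_num) ?_
          rw [show (2 : ℝ) = 1 + 1 by norm_num, Real.exp_add]
          nlinarith
  calc t * L / (16 * N) = t * L / (8 * N) * (1 - 1 / 4 - 1 / 4) := by ring
    _ ≤ t * L / (8 * N) * ∫ ω, (1 - Real.exp (-2) ^ N * Real.exp (1 / 4 * ∑ j, ω j ^ 2) -
          2 ^ L * ∏ j, g (ω j)) ∂(stdGaussian N) := by
        rw [integral_sub (f := fun ω : Fin N → ℝ =>
            1 - Real.exp (-2) ^ N * Real.exp (1 / 4 * ∑ j, ω j ^ 2))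
          ((integrable_const _).sub hi) hi', integral_sub (integrable_const _) hi]
        simp only [integral_const, probReal_univ, smul_eq_mul, one_mul]
        gcongr
    _ ≤ _ := by
        rw [← integral_const_mul]
        refine integral_mono ((((integrable_const _).sub hi).sub hi').const_mul _)
          (integrable_topSum N L) fun ω => ?_
        have hprod : 0 ≤ 2 ^ L * ∏ j, g (ω j) :=
          mul_nonneg (by positivity) (Finset.prod_nonneg fun j _ => hg0 _)
        have hexp : 0 ≤ Real.exp (-2) ^ N * Real.exp (1 / 4 * ∑ j, ω j ^ 2) := by positivity
        have hc : 0 ≤ t * L / (8 * N) := by positivity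
        rcases lt_or_ge (8 * N : ℝ) (∑ j, ω j ^ 2) with hS | hS
        · refine (mul_nonpos_of_nonneg_of_nonpos hc ?_).trans (topSum_nonneg L ω)
          have : 1 ≤ Real.exp (-2) ^ N * Real.exp (1 / 4 * ∑ j, ω j ^ 2) := by
            rw [← Real.exp_nat_mul, ← Real.exp_add]
            exact Real.one_le_exp (by linarith)
          linarith
        rcases lt_or_ge (Finset.univ.filter fun j => t ≤ ω j ^ 2).card L with hK | hK
        · refine (mul_nonpos_of_nonneg_of_nonpos hc ?_).trans (topSum_nonneg L ω)
          have : 1 ≤ 2 ^ L * ∏ j, g (ω j) := by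
            simp only [hg, Finset.prod_ite, Finset.prod_const, one_pow, mul_one, one_div, inv_pow]
            rw [← div_eq_mul_inv, one_le_div (by positivity)]
            exact pow_le_pow_right₀ one_le_two hK.le
          linarith
        obtain ⟨A, hA, hAL⟩ := Finset.exists_subset_card_eq hK
        refine le_trans (mul_le_of_le_one_right hc (by linarith)) ?_
        refine le_trans ?_ (le_topSum ω hAL.le)
        have hAt : t * L ≤ ∑ i ∈ A, ω i ^ 2 := by
          rw [mul_comm, ← hAL, ← nsmul_eq_mul]
          exact A.card_nsmul_le_sum _ _ fun i hi => (Finset.mem_filter.1 (hA hi)).2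
        have hAS : ∑ i ∈ A, ω i ^ 2 ≤ ∑ i, ω i ^ 2 :=
          Finset.sum_le_sum_of_subset_of_nonneg A.subset_univ fun _ _ _ => sq_nonneg _
        rcases ht.eq_or_lt with rfl | ht
        · simp only [zero_mul, zero_div]; positivity
        have : 0 < ∑ i, ω i ^ 2 := lt_of_lt_of_le (by positivity) (hAt.trans hAS)
        gcongr

/-- For a uniform random vector `V` on `S^{N-1}` and `0 < ν ≤ 1/2` (with
`νN ≥ 1`), there are universal constants `C₁, C₂ > 0` with
`C₁ ν log(e/ν) ≤ E[∑_{k ≤ ⌊νN⌋} V_{(k)}²] ≤ C₂ ν log(e/ν)`, where the sum of the `⌊νN⌋`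
largest squared coordinates is expressed as the maximum of `∑_{j ∈ A} V_j²` over
subsets `A` of cardinality at most `⌊νN⌋`. -/
theorem stmt18 :
    ∃ C₁ C₂ : ℝ, 0 < C₁ ∧ 0 < C₂ ∧
      ∀ (N : ℕ) (ν : ℝ), 0 < ν → ν ≤ 1 / 2 → 1 ≤ ν * N →
        C₁ * ν * Real.log (Real.exp 1 / ν) ≤
          (∫ ω, (⨆ A : {A : Finset (Fin N) // A.card ≤ ⌊ν * N⌋₊},
            ∑ j ∈ A.1, unifSphere ω j ^ 2) ∂(stdGaussian N)) ∧
        (∫ ω, (⨆ A : {A : Finset (Fin N) // A.card ≤ ⌊ν * N⌋₊},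
            ∑ j ∈ A.1, unifSphere ω j ^ 2) ∂(stdGaussian N)) ≤
          C₂ * ν * Real.log (Real.exp 1 / ν) := by
  refine ⟨1 / 10000, 60, by norm_num, by norm_num, fun N ν hν hν2 hνN => ?_⟩
  change _ ≤ ∫ ω, topSum ⌊ν * N⌋₊ ω ∂(stdGaussian N) ∧
    ∫ ω, topSum ⌊ν * N⌋₊ ω ∂(stdGaussian N) ≤ _
  have hL : 1 ≤ ⌊ν * N⌋₊ := (Nat.one_le_floor_iff _).2 hνN
  have hLle : (⌊ν * N⌋₊ : ℝ) ≤ ν * N := Nat.floor_le (by positivity)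
  have hLge : ν * N / 2 ≤ (⌊ν * N⌋₊ : ℝ) := by
    have h1 := Nat.lt_floor_add_one (ν * N)
    have h2 : (1 : ℝ) ≤ (⌊ν * N⌋₊ : ℝ) := by exact_mod_cast hL
    linarith
  generalize ⌊ν * N⌋₊ = L at *
  have hN' : (0 : ℝ) < N := pos_of_mul_pos_right (by linarith) hν.le
  have hN : 1 ≤ N := by exact_mod_cast hN'
  have hLN : L ≤ N := by
    have : (L : ℝ) ≤ N := by nlinarith
    exact_mod_cast this
  have hlog : Real.log (Real.exp 1 / ν) = 1 + Real.log ν⁻¹ := by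
    rw [Real.log_div (by positivity) hν.ne', Real.log_exp, Real.log_inv]; ring
  have hl0 : 0 ≤ Real.log ν⁻¹ := Real.log_nonneg ((one_le_inv₀ hν).2 (by linarith))
  rw [hlog]
  constructor
  · rcases le_or_gt ν (1 / 48 ^ 2) with hsmall | hlarge
    · have h48 : 2 * Real.log 48 ≤ Real.log ν⁻¹ := by
        rw [show 2 * Real.log 48 = Real.log (48 ^ 2) by rw [Real.log_pow]; norm_num]
        refine Real.log_le_log (by norm_num) ?_
        rw [le_inv_comm₀ (by norm_num) hν]
        simpa using hsmall
      have h48' : 1 ≤ Real.log 48 := by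
        rw [Real.le_log_iff_exp_le (by norm_num)]
        linarith [Real.exp_one_lt_d9]
      have ht : 0 ≤ Real.log ν⁻¹ - Real.log 48 := by linarith
      have hp := exp_neg_div_eight_le_gaussianReal ht
      have hexp : Real.exp (-(Real.log ν⁻¹ - Real.log 48)) = 48 * ν := by
        rw [Real.log_inv, neg_sub, sub_neg_eq_add, Real.exp_add, Real.exp_log (by norm_num),
          Real.exp_log hν]
      rw [hexp] at hp
      refine le_trans ?_ (le_integral_topSum hN hL ht hp (by linarith))
      rw [le_div_iff₀ (by positivity)]
      calc 1 / 10000 * ν * (1 + Real.log ν⁻¹) * (16 * N)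
          = (1 + Real.log ν⁻¹) / 4 * (ν * N / 2) * (8 * 16 / 10000) := by ring
        _ ≤ (1 + Real.log ν⁻¹) / 4 * (ν * N / 2) :=
            mul_le_of_le_one_right (by positivity) (by norm_num)
        _ ≤ (Real.log ν⁻¹ - Real.log 48) * L := by
            gcongr
            linarith
    · refine le_trans ?_ (half_div_le_integral_topSum hN hLN)
      have h1 : ν⁻¹ ≤ 48 ^ 2 := by
        rw [inv_le_comm₀ hν (by norm_num)]
        simpa using hlarge.le
      have h2 := Real.log_le_sub_one_of_pos (inv_pos.2 hν)
      have h3 : ν / 2 ≤ L / N := by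
        rw [le_div_iff₀ hN']; linarith
      nlinarith
  · refine (integral_topSum_le hN L (t := 4 * Real.log ν⁻¹) (by positivity)).trans ?_
    have hexp : Real.exp (-(4 * Real.log ν⁻¹) / 4) = ν := by
      rw [Real.log_inv, show -(4 * -Real.log ν) / 4 = Real.log ν by ring, Real.exp_log hν]
    have hs2 : √2 ≤ 1.5 := by rw [Real.sqrt_le_left (by norm_num)]; norm_num
    have hpow : (3 / 4 : ℝ) ^ N ≤ 3 * ν := by
      have hb := one_add_mul_le_pow (a := (1 / 3 : ℝ)) (by norm_num) N
      have hmul : (3 / 4 : ℝ) ^ N * (1 + 1 / 3) ^ N = 1 := by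
        rw [← mul_pow]; norm_num
      have hq : (0 : ℝ) < (3 / 4) ^ N := by positivity
      have : (3 / 4 : ℝ) ^ N * N ≤ 3 * ν * N := by nlinarith
      exact le_of_mul_le_mul_right this hN'
    rw [hexp]
    calc 4 / N * (L * (4 * Real.log ν⁻¹) + N * (4 * ν * √2)) + (3 / 4) ^ N
        ≤ 4 / N * (ν * N * (4 * Real.log ν⁻¹) + N * (4 * ν * 1.5)) + 3 * ν := by gcongr
      _ = ν * (16 * Real.log ν⁻¹ + 27) := by field_simp; ring
      _ ≤ 60 * ν * (1 + Real.log ν⁻¹) := by nlinarith [mul_nonneg hν.le hl0]
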